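/- The Baouendi-Grushin Laplacian of the gauge norm satisfies Δ_X ρ = ((Q−1)/ρ)·ψ on {x ≠ 0}, where Q = m + (α+1)n is the homogeneous dimension and ψ = |x|^{2α}/ρ^{2α}. -/

import Mathlib

open MeasureTheory Real

noncomputable section

abbrev E (m n : ℕ) := EuclideanSpace ℝ (Fin m) × EuclideanSpace ℝ (Fin n)

/-- The gauge norm `ρ(x,y) = (|x|^{2(α+1)} + (α+1)²|y|²)^{1/(2(α+1))}`. -/
def rho {m n : ℕ} (α : ℝ) (z : E m n) : ℝ :=
  (‖z.1‖ ^ (2*(α+1)) + (α+1)^2 * ‖z.2‖^2) ^ (1/(2*(α+1)))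

/-- The angle function `ψ = |x|^{2α}/ρ^{2α}`. -/
def psi {m n : ℕ} (α : ℝ) (z : E m n) : ℝ :=
  ‖z.1‖ ^ (2*α) / (rho α z) ^ (2*α)

/-- The gauge ball of radius `r`. -/
def gball {m n : ℕ} (α r : ℝ) : Set (E m n) := {z | rho α z < r}

/-- The gauge sphere of radius `r`. -/
def gsphere {m n : ℕ} (α r : ℝ) : Set (E m n) := {z | rho α z = r}

/-- Squared norm of the Baouendi-Grushin gradient `∇_X u = (∇_x u, |x|^α ∇_y u)`. -/
def gradXsq {m n : ℕ} (α : ℝ) (u : E m n → ℝ) (z : E m n) : ℝ :=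
  (∑ i, (fderiv ℝ u z (EuclideanSpace.single i 1, 0))^2)
  + ‖z.1‖ ^ (2*α) * (∑ j, (fderiv ℝ u z (0, EuclideanSpace.single j 1))^2)

/-- The Baouendi-Grushin Laplacian `Δ_X u = Δ_x u + |x|^{2α} Δ_y u`. -/
def lapX {m n : ℕ} (α : ℝ) (u : E m n → ℝ) (z : E m n) : ℝ :=
  (∑ i, fderiv ℝ (fun w => fderiv ℝ u w (EuclideanSpace.single i 1, 0)) z
      (EuclideanSpace.single i 1, 0))
  + ‖z.1‖ ^ (2*α) *
    (∑ j, fderiv ℝ (fun w => fderiv ℝ u w (0, EuclideanSpace.single j 1)) z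
      (0, EuclideanSpace.single j 1))

/-- The generator of anisotropic dilations `Zu = x·∇_x u + (α+1) y·∇_y u`. -/
def Zop {m n : ℕ} (α : ℝ) (u : E m n → ℝ) (z : E m n) : ℝ :=
  fderiv ℝ u z (z.1, (α+1) • z.2)

/-- Euclidean norm of the full gradient of `ρ`. -/
def normGradRho {m n : ℕ} (α : ℝ) (z : E m n) : ℝ :=
  Real.sqrt ((∑ i, (fderiv ℝ (rho α) z (EuclideanSpace.single i 1, 0))^2)
    + (∑ j, (fderiv ℝ (rho α) z (0, EuclideanSpace.single j 1))^2))


open Topology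

theorem hasFDerivAt_norm_fst_rpow {m n : ℕ} (q : ℝ) {z : E m n} (hz : z.1 ≠ 0) :
    HasFDerivAt (fun w : E m n => ‖w.1‖ ^ q)
      ((q * ‖z.1‖ ^ (q - 2)) • (innerSL ℝ z.1).comp
        (ContinuousLinearMap.fst ℝ (EuclideanSpace ℝ (Fin m)) (EuclideanSpace ℝ (Fin n)))) z := by
  have hpow (x : EuclideanSpace ℝ (Fin m)) (r : ℝ) : (‖x‖ ^ 2) ^ r = ‖x‖ ^ (2 * r) := by
    rw [← Real.rpow_natCast, ← Real.rpow_mul (norm_nonneg _)]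
    norm_num
  have h := ((hasFDerivAt_fst (𝕜 := ℝ) (p := z)).norm_sq).rpow_const (p := q / 2)
    (Or.inl (by positivity))
  have hfun : (fun w : E m n => ‖w.1‖ ^ q) = fun w : E m n => (‖w.1‖ ^ 2) ^ (q / 2) := by
    ext w
    rw [hpow, mul_div_cancel₀ q two_ne_zero]
  rw [hfun]
  refine h.congr_fderiv ?_
  ext v
  all_goals
    simp [hpow, show 2 * (q / 2 - 1) = q - 2 by ring]
    try ring

/-- The gauge `ρ` is a power of this function. -/
def gaugeBase {m n : ℕ} (α : ℝ) (z : E m n) : ℝ :=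
  ‖z.1‖ ^ (2*(α+1)) + (α+1)^2 * ‖z.2‖^2

theorem gaugeBase_pos {m n : ℕ} (α : ℝ) {z : E m n} (hz : z.1 ≠ 0) : 0 < gaugeBase α z := by
  have : 0 < ‖z.1‖ := norm_pos_iff.mpr hz
  unfold gaugeBase
  positivity

theorem hasFDerivAt_gaugeBase_rpow {m n : ℕ} (α p : ℝ) {z : E m n} (hz : z.1 ≠ 0) :
    HasFDerivAt (fun w : E m n => gaugeBase α w ^ p)
      ((p * gaugeBase α z ^ (p - 1)) •
        ((2 * (α + 1) * ‖z.1‖ ^ (2 * α)) • (innerSL ℝ z.1).comp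
          (ContinuousLinearMap.fst ℝ (EuclideanSpace ℝ (Fin m)) (EuclideanSpace ℝ (Fin n)))
        + (2 * (α + 1) ^ 2) • (innerSL ℝ z.2).comp
          (ContinuousLinearMap.snd ℝ (EuclideanSpace ℝ (Fin m)) (EuclideanSpace ℝ (Fin n))))) z := by
  have h := (hasFDerivAt_norm_fst_rpow (2 * (α + 1)) hz).add
    (((hasFDerivAt_snd (𝕜 := ℝ) (p := z)).norm_sq).const_mul ((α + 1) ^ 2))
  refine (h.rpow_const (p := p) (Or.inl (gaugeBase_pos α hz).ne')).congr_fderiv ?_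
  rw [show 2 * (α + 1) - 2 = 2 * α by ring]
  ext v
  all_goals
    simp [gaugeBase, -mul_eq_mul_left_iff]
    try ring

theorem fderiv_rho_fst {m n : ℕ} {α : ℝ} (hα : 0 < α) {z : E m n} (hz : z.1 ≠ 0) (i : Fin m) :
    fderiv ℝ (rho α) z (EuclideanSpace.single i 1, 0) =
      gaugeBase α z ^ (1 / (2 * (α + 1)) - 1) * (‖z.1‖ ^ (2 * α) * z.1 i) := by
  have h : fderiv ℝ (rho α) z = _ :=
    (hasFDerivAt_gaugeBase_rpow α (1 / (2 * (α + 1))) hz).fderiv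
  have : α + 1 ≠ 0 := by positivity
  rw [h]
  simp [EuclideanSpace.inner_single_right]
  field_simp

theorem fderiv_rho_snd {m n : ℕ} {α : ℝ} (hα : 0 < α) {z : E m n} (hz : z.1 ≠ 0) (j : Fin n) :
    fderiv ℝ (rho α) z (0, EuclideanSpace.single j 1) =
      gaugeBase α z ^ (1 / (2 * (α + 1)) - 1) * ((α + 1) * z.2 j) := by
  have h : fderiv ℝ (rho α) z = _ :=
    (hasFDerivAt_gaugeBase_rpow α (1 / (2 * (α + 1))) hz).fderiv
  have : α + 1 ≠ 0 := by positivity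
  rw [h]
  simp [EuclideanSpace.inner_single_right]
  field_simp

theorem eventually_fst_ne_zero {m n : ℕ} {z : E m n} (hz : z.1 ≠ 0) : ∀ᶠ w in 𝓝 z, w.1 ≠ 0 :=
  continuous_fst.continuousAt.eventually_ne hz

theorem fderiv_fderiv_rho_fst {m n : ℕ} {α : ℝ} (hα : 0 < α) {z : E m n} (hz : z.1 ≠ 0)
    (i : Fin m) :
    fderiv ℝ (fun w => fderiv ℝ (rho α) w (EuclideanSpace.single i 1, 0)) z
      (EuclideanSpace.single i 1, 0) =
      ((1 / (2 * (α + 1)) - 1) * gaugeBase α z ^ (1 / (2 * (α + 1)) - 2) *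
          (2 * (α + 1) * (‖z.1‖ ^ (2 * α)) ^ 2)
        + gaugeBase α z ^ (1 / (2 * (α + 1)) - 1) * (2 * α * ‖z.1‖ ^ (2 * α - 2))) * z.1 i ^ 2
      + gaugeBase α z ^ (1 / (2 * (α + 1)) - 1) * ‖z.1‖ ^ (2 * α) := by
  have hev : (fun w => fderiv ℝ (rho α) w (EuclideanSpace.single i 1, 0)) =ᶠ[𝓝 z]
      fun w : E m n => gaugeBase α w ^ (1 / (2 * (α + 1)) - 1) * (‖w.1‖ ^ (2 * α) * w.1 i) :=
    (eventually_fst_ne_zero hz).mono fun w hw => fderiv_rho_fst hα hw i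
  have hcoord : HasFDerivAt (fun w : E m n => w.1 i) _ z :=
    ((EuclideanSpace.proj i : EuclideanSpace ℝ (Fin m) →L[ℝ] ℝ).comp
      (ContinuousLinearMap.fst ℝ (EuclideanSpace ℝ (Fin m))
        (EuclideanSpace ℝ (Fin n)))).hasFDerivAt
  have h := (hasFDerivAt_gaugeBase_rpow α (1 / (2 * (α + 1)) - 1) hz).fun_mul
    ((hasFDerivAt_norm_fst_rpow (2 * α) hz).fun_mul hcoord)
  rw [hev.fderiv_eq, h.fderiv]
  rw [show 1 / (2 * (α + 1)) - 2 = 1 / (2 * (α + 1)) - 1 - 1 by ring]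
  simp [EuclideanSpace.inner_single_right, -one_div]
  ring

theorem fderiv_fderiv_rho_snd {m n : ℕ} {α : ℝ} (hα : 0 < α) {z : E m n} (hz : z.1 ≠ 0)
    (j : Fin n) :
    fderiv ℝ (fun w => fderiv ℝ (rho α) w (0, EuclideanSpace.single j 1)) z
      (0, EuclideanSpace.single j 1) =
      (1 / (2 * (α + 1)) - 1) * gaugeBase α z ^ (1 / (2 * (α + 1)) - 2) *
          (2 * (α + 1) ^ 3) * z.2 j ^ 2
      + gaugeBase α z ^ (1 / (2 * (α + 1)) - 1) * (α + 1) := by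
  have hev : (fun w => fderiv ℝ (rho α) w (0, EuclideanSpace.single j 1)) =ᶠ[𝓝 z]
      fun w : E m n => gaugeBase α w ^ (1 / (2 * (α + 1)) - 1) * ((α + 1) * w.2 j) :=
    (eventually_fst_ne_zero hz).mono fun w hw => fderiv_rho_snd hα hw j
  have hcoord : HasFDerivAt (fun w : E m n => w.2 j) _ z :=
    ((EuclideanSpace.proj j : EuclideanSpace ℝ (Fin n) →L[ℝ] ℝ).comp
      (ContinuousLinearMap.snd ℝ (EuclideanSpace ℝ (Fin m))
        (EuclideanSpace ℝ (Fin n)))).hasFDerivAt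
  have h := (hasFDerivAt_gaugeBase_rpow α (1 / (2 * (α + 1)) - 1) hz).fun_mul
    (hcoord.const_mul (α + 1))
  rw [hev.fderiv_eq, h.fderiv]
  rw [show 1 / (2 * (α + 1)) - 2 = 1 / (2 * (α + 1)) - 1 - 1 by ring]
  simp [EuclideanSpace.inner_single_right, -one_div]
  ring

/-- `Δ_X ρ = ((Q−1)/ρ) ψ` on `{x ≠ 0}`, with `Q = m + (α+1)n`. -/
theorem lapX_rho {m n : ℕ} (hm : 1 ≤ m) (hn : 1 ≤ n) (α : ℝ) (hα : 0 < α)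
    (z : E m n) (hz : z.1 ≠ 0) :
    lapX α (rho α) z = (((m : ℝ) + (α+1) * n - 1) / rho α z) * psi α z := by
  have hx : 0 < ‖z.1‖ := norm_pos_iff.mpr hz
  have hG := gaugeBase_pos α hz
  have ha : α + 1 ≠ 0 := by positivity
  have hrhs : (((m : ℝ) + (α+1) * n - 1) / rho α z) * psi α z =
      ((m : ℝ) + (α+1) * n - 1) * ‖z.1‖ ^ (2 * α) *
        gaugeBase α z ^ (1 / (2 * (α + 1)) - 1) := by
    have hrho : 0 < rho α z := Real.rpow_pos_of_pos hG _
    have hprod : rho α z * rho α z ^ (2 * α) * gaugeBase α z ^ (1 / (2 * (α + 1)) - 1) = 1 := by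
      change gaugeBase α z ^ (1 / (2 * (α + 1))) *
        (gaugeBase α z ^ (1 / (2 * (α + 1)))) ^ (2 * α) * _ = 1
      rw [← Real.rpow_mul hG.le, ← Real.rpow_add hG, ← Real.rpow_add hG]
      convert Real.rpow_zero (gaugeBase α z) using 2
      field_simp
      ring
    have hpow := Real.rpow_pos_of_pos hrho (2 * α)
    rw [psi, div_mul_div_comm, div_eq_iff (by positivity)]
    linear_combination -((m : ℝ) + (α+1) * n - 1) * ‖z.1‖ ^ (2 * α) * hprod
  have hstep : gaugeBase α z ^ (1 / (2 * (α + 1)) - 1) =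
      gaugeBase α z ^ (1 / (2 * (α + 1)) - 2) * gaugeBase α z := by
    rw [← Real.rpow_add_one hG.ne']
    congr 1
    ring
  have hxpow : ‖z.1‖ ^ (2 * α) = ‖z.1‖ ^ (2 * α - 2) * ‖z.1‖ ^ 2 := by
    rw [← Real.rpow_natCast, ← Real.rpow_add hx]
    congr 1
    norm_num
  have hbase : gaugeBase α z = ‖z.1‖ ^ (2 * α) * ‖z.1‖ ^ 2 + (α + 1) ^ 2 * ‖z.2‖ ^ 2 := by
    rw [gaugeBase, ← Real.rpow_natCast ‖z.1‖, ← Real.rpow_add hx]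
    congr 2
    push_cast
    ring
  have hcoef : (1 / (2 * (α + 1)) - 1) * (2 * (α + 1)) = 1 - 2 * (α + 1) := by
    field_simp
  rw [hrhs, lapX]
  simp only [fderiv_fderiv_rho_fst hα hz, fderiv_fderiv_rho_snd hα hz, Finset.sum_add_distrib,
    ← Finset.mul_sum, ← EuclideanSpace.real_norm_sq_eq, Finset.sum_const, Finset.card_univ,
    Fintype.card_fin, nsmul_eq_mul]
  generalize gaugeBase α z ^ (1 / (2 * (α + 1)) - 1) = A at *
  generalize gaugeBase α z ^ (1 / (2 * (α + 1)) - 2) = B at *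
  generalize gaugeBase α z = G at *
  generalize ‖z.1‖ ^ (2 * α - 2) = D at *
  generalize ‖z.1‖ ^ (2 * α) = C at *
  generalize 1 / (2 * (α + 1)) - 1 = k at *
  linear_combination (B * C * (C * ‖z.1‖ ^ 2 + (α + 1) ^ 2 * ‖z.2‖ ^ 2)) * hcoef
    - (1 - 2 * (α + 1)) * B * C * hbase - (1 - 2 * (α + 1)) * C * hstep - 2 * α * A * hxpow
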